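/- arXiv:1409.7983 — 2 statements merged into one kernel-verified Lean document; each statement's English description precedes it below -/
import Mathlib

section
/- Let T be a tree with at least one edge, and for each edge e of T let T_1, T_2 be the two connected components of T − e. Let k = min over edges e of T of max(cd(T_1), cd(T_2)). If k < cd(T), then for every n ≥ k+1 there exists a (Q_n, T)-saturated subgraph of Q_n with exactly k·2^(n−1) edges; in particular sat(Q_n, T) ≤ k·2^(n−1). -/
open SimpleGraph

/-- The hypercube graph `Q_n` on vertex set `{0,1}^n`: two vertices are adjacent
iff they differ in exactly one coordinate. -/
def hypercube (n : ℕ) : SimpleGraph (Fin n → Bool) :=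
  SimpleGraph.fromRel (fun u v => hammingDist u v = 1)

/-- `HasCopy H G` means `H` contains a subgraph isomorphic to `G`. -/
def HasCopy {V W : Type*} (H : SimpleGraph V) (G : SimpleGraph W) : Prop :=
  ∃ f : G →g H, Function.Injective f

/-- `IsSat Host H G`: `H` is an `(Host, G)`-saturated subgraph of `Host`. -/
def IsSat {V W : Type*} (Host H : SimpleGraph V) (G : SimpleGraph W) : Prop :=
  H ≤ Host ∧ ¬ HasCopy H G ∧
    ∀ u v : V, Host.Adj u v → ¬ H.Adj u v →
      HasCopy (H ⊔ SimpleGraph.fromEdgeSet {s(u, v)}) G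

/-- The saturation number `sat(Host, G)`. -/
noncomputable def satNum {V W : Type*} (Host : SimpleGraph V) (G : SimpleGraph W) : ℕ :=
  sInf { m | ∃ H : SimpleGraph V, IsSat Host H G ∧ H.edgeSet.ncard = m }

/-- The cubical dimension of a graph: the smallest positive `d` such that
the graph embeds as a subgraph of `Q_d`. -/
noncomputable def cubicalDim {V : Type*} (T : SimpleGraph V) : ℕ :=
  sInf { d | 0 < d ∧ HasCopy (hypercube d) T }

/-- The connected component of `w` in `T` with the edge `uv` deleted,
as an induced graph. -/
def compAt {V : Type*} (T : SimpleGraph V) (u v w : V) :=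
  (T.deleteEdges {s(u, v)}).induce ((T.deleteEdges {s(u, v)}).connectedComponentMk w).supp

theorem hypercube_adj_iff {n : ℕ} {u v : Fin n → Bool} :
    (hypercube n).Adj u v ↔ ∃ i, ∀ j, u j ≠ v j ↔ j = i := by
  have h : (hypercube n).Adj u v ↔ hammingDist u v = 1 := by
    simp only [hypercube, SimpleGraph.fromRel_adj, hammingDist_comm v u, or_self,
      and_iff_right_iff_imp]
    rintro h rfl
    simp at h
  rw [h, hammingDist, Finset.card_eq_one]
  simp [Finset.ext_iff]

/-- The spanning subgraph of `hypercube n` using only the first `k` directions: a disjoint union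
of copies of `hypercube k`. -/
def subcubes (n k : ℕ) : SimpleGraph (Fin n → Bool) where
  Adj u v := (hypercube n).Adj u v ∧ ∀ i : Fin n, k ≤ i → u i = v i
  symm := ⟨fun _ _ h => ⟨h.1.symm, fun i hi => (h.2 i hi).symm⟩⟩
  loopless := ⟨fun _ h => h.1.ne rfl⟩

theorem subcubes_le (n k : ℕ) : subcubes n k ≤ hypercube n := fun _ _ h => h.1

theorem subcubes_adj_iff {n k : ℕ} {u v : Fin n → Bool} :
    (subcubes n k).Adj u v ↔ ∃ i : Fin n, (i : ℕ) < k ∧ v = Function.update u i (!u i) := by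
  simp only [subcubes, hypercube_adj_iff]
  constructor
  · rintro ⟨⟨i, hi⟩, h⟩
    refine ⟨i, ?_, ?_⟩
    · by_contra! hki
      exact (hi i).2 rfl (h i hki)
    · funext j
      by_cases hj : j = i
      · subst hj
        have := (hi j).2 rfl
        simpa [Bool.eq_not] using Ne.symm this
      · have := mt (hi j).1 hj
        simp only [Function.update_of_ne hj]
        grind
  · rintro ⟨i, hi, rfl⟩
    refine ⟨⟨i, fun j => ?_⟩, fun j hj => ?_⟩
    · by_cases h : j = i
      · subst h; simp
      · simp [h]
    · have : j ≠ i := by rintro rfl; omega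
      simp [this]

theorem ncard_edgeSet_subcubes {n k : ℕ} (hkn : k + 1 ≤ n) :
    (subcubes n k).edgeSet.ncard = k * 2 ^ (n - 1) := by
  classical
  have hdeg : ∀ u, (subcubes n k).degree u = k := by
    intro u
    have hN : (subcubes n k).neighborFinset u =
        (Finset.univ.filter fun i : Fin n => (i : ℕ) < k).image
          fun i => Function.update u i (!u i) := by
      ext v
      simp [subcubes_adj_iff, eq_comm]
    rw [← SimpleGraph.card_neighborFinset_eq_degree, hN, Finset.card_image_of_injective]
    · rw [Fin.card_filter_val_lt]
      omega
    · intro i j hij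
      by_contra hne
      have := congrFun hij i
      simp [Function.update_of_ne hne] at this
  have hsum := (subcubes n k).sum_degrees_eq_twice_card_edges
  simp only [hdeg, Finset.sum_const, Finset.card_univ, Fintype.card_pi, Fintype.card_bool,
    Finset.prod_const, Fintype.card_fin, smul_eq_mul] at hsum
  rw [← SimpleGraph.coe_edgeFinset, Set.ncard_coe_finset]
  obtain ⟨m, rfl⟩ : ∃ m, n = m + 1 := ⟨n - 1, by omega⟩
  rw [pow_succ] at hsum
  simp only [Nat.add_sub_cancel]
  linarith

theorem not_hasCopy_subcubes {V : Type*} {T : SimpleGraph V} (hT : T.Connected) {n k : ℕ}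
    (hk : 0 < k) (hkn : k ≤ n) (hlt : k < cubicalDim T) : ¬ HasCopy (subcubes n k) T := by
  rintro ⟨f, hf⟩
  have hconst : ∀ a b, ∀ i : Fin n, k ≤ i → f a i = f b i := by
    intro a b i hi
    obtain ⟨p⟩ := hT.preconnected a b
    induction p with
    | nil => rfl
    | cons h _ ih => exact ((f.map_adj h).2 i hi).trans ih
  refine absurd (Nat.sInf_le (s := {d | 0 < d ∧ HasCopy (hypercube d) T})
    ⟨hk, ⟨fun a i => f a (Fin.castLE hkn i), ?_⟩, ?_⟩) (not_le.2 hlt)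
  · intro a b hab
    obtain ⟨h, h'⟩ := f.map_adj hab
    obtain ⟨i, hi⟩ := hypercube_adj_iff.1 h
    have hik : (i : ℕ) < k := by
      by_contra! hki
      exact (hi i).2 rfl (h' i hki)
    refine hypercube_adj_iff.2 ⟨⟨i, hik⟩, fun j => (hi _).trans ?_⟩
    simp [Fin.ext_iff]
  · intro a b hab
    apply hf
    funext i
    by_cases hi : (i : ℕ) < k
    · exact congrFun hab ⟨i, hi⟩
    · exact hconst a b i (not_lt.1 hi)

theorem HasCopy.exists_subcubes {W : Type*} {G : SimpleGraph W} {d : ℕ}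
    (h : HasCopy (hypercube d) G) {n k : ℕ} (hdk : d ≤ k) (hkn : k ≤ n) (x : W)
    (u : Fin n → Bool) :
    ∃ f : G →g subcubes n k, Function.Injective f ∧ f x = u ∧
      ∀ w, ∀ i : Fin n, k ≤ i → f w i = u i := by
  obtain ⟨f, hf⟩ := h
  let g : W → Fin n → Bool := fun w i =>
    if hi : (i : ℕ) < d then (f w ⟨i, hi⟩ ^^ (f x ⟨i, hi⟩ ^^ u i)) else u i
  refine ⟨⟨g, fun {a b} hab => ?_⟩, fun a b hab => ?_, ?_, ?_⟩
  · obtain ⟨i, hi⟩ := hypercube_adj_iff.1 (f.map_adj hab)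
    refine ⟨hypercube_adj_iff.2 ⟨⟨i, by omega⟩, fun j => ?_⟩, fun j hj => ?_⟩
    · by_cases hj : (j : ℕ) < d
      · have := hi ⟨j, hj⟩
        simp only [g, hj, dif_pos, ne_eq, Bool.xor_left_inj, Fin.ext_iff] at this ⊢
        exact this
      · have : (j : ℕ) ≠ i := by omega
        simp [g, hj, Fin.ext_iff, this]
    · have : ¬ (j : ℕ) < d := by omega
      simp [g, this]
  · apply hf
    funext i
    have := congrFun hab ⟨i, by omega⟩
    simpa [g] using this
  · funext i
    simp only [g, RelHom.coeFn_mk]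
    split <;> simp
  · intro w i hi
    have : ¬ (i : ℕ) < d := by omega
    simp [g, this]

theorem HasCopy.of_injective {V W X : Type*} {H : SimpleGraph X} {G : SimpleGraph V}
    {G' : SimpleGraph W} (h : HasCopy H G) (g : G' →g G) (hg : Function.Injective g) :
    HasCopy H G' :=
  h.elim fun f hf => ⟨f.comp g, hf.comp hg⟩

theorem cubicalDim_spec {V : Type*} {T : SimpleGraph V} {d : ℕ} (hd : 0 < d)
    (h : HasCopy (hypercube d) T) :
    0 < cubicalDim T ∧ HasCopy (hypercube (cubicalDim T)) T :=
  Nat.sInf_mem (s := {d | 0 < d ∧ HasCopy (hypercube d) T}) ⟨d, hd, h⟩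

theorem cubicalDim_spec_of_pos {V : Type*} {T : SimpleGraph V} (h : 0 < cubicalDim T) :
    HasCopy (hypercube (cubicalDim T)) T :=
  (Nat.sInf_mem (Nat.nonempty_of_pos_sInf h)).2

/-- The inclusion of a component of `T - uv` into `T`. -/
def compAtHom {V : Type*} (T : SimpleGraph V) (u v w : V) : compAt T u v w →g T where
  toFun := Subtype.val
  map_rel' h := T.deleteEdges_le _ h

theorem SimpleGraph.Connected.reachable_deleteEdges {V : Type*} {T : SimpleGraph V}
    (hT : T.Connected) (x y w : V) :
    (T.deleteEdges {s(x, y)}).Reachable w x ∨ (T.deleteEdges {s(x, y)}).Reachable w y := by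
  suffices h : ∀ z, T.Walk w z → z = x →
      (T.deleteEdges {s(x, y)}).Reachable w x ∨ (T.deleteEdges {s(x, y)}).Reachable w y from
    (hT.preconnected w x).elim fun p => h x p rfl
  intro z p hz
  induction p with
  | nil => subst hz; exact Or.inl .rfl
  | @cons a b c h p ih =>
    by_cases he : s(a, b) = s(x, y)
    · rcases Sym2.eq_iff.1 he with ⟨rfl, -⟩ | ⟨rfl, -⟩
      · exact Or.inl .rfl
      · exact Or.inr .rfl
    · have hab : (T.deleteEdges {s(x, y)}).Adj a b := by simp [h, he]
      exact (ih hz).imp hab.reachable.trans hab.reachable.trans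

theorem hasCopy_sup_edge {V : Type*} {T : SimpleGraph V} (hT : T.IsTree) {x y : V}
    (hxy : T.Adj x y) {n k : ℕ} (hkn : k ≤ n) {d₁ d₂ : ℕ} (hd₁ : d₁ ≤ k) (hd₂ : d₂ ≤ k)
    (h₁ : HasCopy (hypercube d₁) (compAt T x y x))
    (h₂ : HasCopy (hypercube d₂) (compAt T x y y)) {u v : Fin n → Bool}
    (huv : (hypercube n).Adj u v) (huv' : ¬ (subcubes n k).Adj u v) :
    HasCopy (subcubes n k ⊔ SimpleGraph.fromEdgeSet {s(u, v)}) T := by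
  classical
  obtain ⟨i, hi, hui⟩ : ∃ i : Fin n, k ≤ i ∧ u i ≠ v i := by
    by_contra! h
    exact huv' ⟨huv, h⟩
  obtain ⟨f₁, hf₁, hx, hu⟩ := h₁.exists_subcubes hd₁ hkn ⟨x, rfl⟩ u
  obtain ⟨f₂, hf₂, hy, hv⟩ := h₂.exists_subcubes hd₂ hkn ⟨y, rfl⟩ v
  set D := T.deleteEdges {s(x, y)} with hD
  set A := (D.connectedComponentMk x).supp with hA
  set B := (D.connectedComponentMk y).supp with hB
  have hmemA : ∀ w, w ∈ A ↔ D.Reachable w x := fun w => by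
    rw [hA, SimpleGraph.ConnectedComponent.mem_supp_iff, SimpleGraph.ConnectedComponent.eq]
  have hmemB : ∀ w, w ∈ B ↔ D.Reachable w y := fun w => by
    rw [hB, SimpleGraph.ConnectedComponent.mem_supp_iff, SimpleGraph.ConnectedComponent.eq]
  have hAB : ∀ w, w ∉ A → w ∈ B := fun w hw =>
    (hmemB w).2 ((hT.connected.reachable_deleteEdges x y w).resolve_left (mt (hmemA w).2 hw))
  have hyA : y ∉ A := fun h =>
    SimpleGraph.isBridge_iff.1 (SimpleGraph.isAcyclic_iff_forall_adj_isBridge.1 hT.isAcyclic hxy)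
      ((hmemA y).1 h).symm
  have hxA : x ∈ A := (hmemA x).2 .rfl
  let F : V → Fin n → Bool := fun w => if h : w ∈ A then f₁ ⟨w, h⟩ else f₂ ⟨w, hAB w h⟩
  have hFx : F x = u := by simp only [F, dif_pos hxA]; exact hx
  have hFy : F y = v := by simp only [F, dif_neg hyA]; exact hy
  refine ⟨⟨F, fun {a b} hab => ?_⟩, fun a b hab => ?_⟩
  · by_cases he : s(a, b) = s(x, y)
    · right
      rcases Sym2.eq_iff.1 he with ⟨rfl, rfl⟩ | ⟨rfl, rfl⟩
      · rw [hFx, hFy]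
        simp [huv.ne]
      · rw [hFx, hFy]
        simp [huv.ne', Sym2.eq_swap]
    · left
      have hDab : D.Adj a b := by simp [hD, hab, he]
      by_cases ha : a ∈ A
      · have hb : b ∈ A := (hmemA b).2 (hDab.symm.reachable.trans ((hmemA a).1 ha))
        simp only [F, dif_pos ha, dif_pos hb]
        exact f₁.map_adj hDab
      · have hb : b ∉ A := fun hb => ha ((hmemA a).2 (hDab.reachable.trans ((hmemA b).1 hb)))
        simp only [F, dif_neg ha, dif_neg hb]
        exact f₂.map_adj hDab
  · change F a = F b at hab
    by_cases ha : a ∈ A <;> by_cases hb : b ∈ A <;>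
      simp only [F, ha, hb, dif_pos, dif_neg, not_false_eq_true] at hab
    · exact congrArg Subtype.val (hf₁ hab)
    · exact absurd (((hu _ i hi).symm.trans (congrFun hab i)).trans (hv _ i hi)) hui
    · exact absurd (((hu _ i hi).symm.trans (congrFun hab.symm i)).trans (hv _ i hi)) hui
    · exact congrArg Subtype.val (hf₂ hab)

/-- if `k`, the minimum over edges `e` of `T` of the larger of the
cubical dimensions of the two components of `T - e`, satisfies `k < cd(T)`, then
for every `n ≥ k+1` there is a `(Q_n, T)`-saturated subgraph with exactly
`k·2^(n-1)` edges; in particular `sat(Q_n, T) ≤ k·2^(n-1)`. -/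
theorem stmt1 {V : Type*} [Fintype V] (T : SimpleGraph V) (hT : T.IsTree)
    (hne : T.edgeSet.Nonempty) (k : ℕ)
    (hk : k = sInf { x | ∃ u v : V, T.Adj u v ∧
        x = max (cubicalDim (compAt T u v u)) (cubicalDim (compAt T u v v)) })
    (hlt : k < cubicalDim T) :
    ∀ n : ℕ, k + 1 ≤ n →
      (∃ H : SimpleGraph (Fin n → Bool), IsSat (hypercube n) H T ∧
          H.edgeSet.ncard = k * 2 ^ (n - 1)) ∧
        satNum (hypercube n) T ≤ k * 2 ^ (n - 1) := by
  intro n hn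
  obtain ⟨x, y, hxy, hkxy⟩ : ∃ x y : V, T.Adj x y ∧
      k = max (cubicalDim (compAt T x y x)) (cubicalDim (compAt T x y y)) := by
    have hmem := Nat.sInf_mem (s := { x | ∃ u v : V, T.Adj u v ∧
        x = max (cubicalDim (compAt T u v u)) (cubicalDim (compAt T u v v)) }) ?_
    · rwa [← hk] at hmem
    · obtain ⟨e, he⟩ := hne
      induction e with
      | h a b => exact ⟨_, a, b, he, rfl⟩
  have hpos : 0 < cubicalDim T := by omega
  have hcopy := cubicalDim_spec_of_pos hpos
  obtain ⟨hp₁, h₁⟩ := cubicalDim_spec hpos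
    (hcopy.of_injective (compAtHom T x y x) Subtype.val_injective)
  obtain ⟨-, h₂⟩ := cubicalDim_spec hpos
    (hcopy.of_injective (compAtHom T x y y) Subtype.val_injective)
  have hd₁ : cubicalDim (compAt T x y x) ≤ k := hkxy ▸ le_max_left _ _
  have hd₂ : cubicalDim (compAt T x y y) ≤ k := hkxy ▸ le_max_right _ _
  have hkn : k ≤ n := by omega
  have hsat : IsSat (hypercube n) (subcubes n k) T :=
    ⟨subcubes_le n k, not_hasCopy_subcubes hT.connected (hp₁.trans_le hd₁) hkn hlt,
      fun u v => hasCopy_sup_edge hT hxy hkn hd₁ hd₂ h₁ h₂⟩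
  have hcard := ncard_edgeSet_subcubes hn
  exact ⟨⟨_, hsat, hcard⟩, Nat.sInf_le ⟨_, hsat, hcard⟩⟩
end

section
/- For all integers k ≥ r ≥ 2, for all sufficiently large n, sat(Q_n, S_{k×r}) ≤ r · 2^(n−1). -/
open SimpleGraph

/-- Number of spine-neighbors of the `i`-th spine vertex (0-based) of a
caterpillar with `m` spine vertices. -/
def spineExtra (m i : ℕ) : ℕ := (if i = 0 then 0 else 1) + (if i = m - 1 then 0 else 1)

/-- The caterpillar `S_{k 0 × k 1 × ⋯ × k (m-1)}`: the vertices of degree `> 1`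
form a path of `m` vertices (the spine) whose `i`-th vertex has degree `k i`;
all other vertices are leaves attached to the spine. -/
def caterpillar (m : ℕ) (k : ℕ → ℕ) :
    SimpleGraph (Fin m ⊕ Σ i : Fin m, Fin (k (i : ℕ) - spineExtra m (i : ℕ))) :=
  SimpleGraph.fromRel (fun u v =>
    match u, v with
    | Sum.inl a, Sum.inl b => (a : ℕ) + 1 = (b : ℕ)
    | Sum.inl a, Sum.inr p => a = p.1
    | _, _ => False)

/-- A copy of the double star `S_{k×r}` provides adjacent vertices of degrees at least `k`
and `r`. -/
lemma exists_adj_of_hasCopy_doubleStar {V : Type*} [Finite V] {H : SimpleGraph V} {k r : ℕ}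
    (h : HasCopy H (caterpillar 2 (fun t => if t = 0 then k else r))) :
    ∃ x y, H.Adj x y ∧ k ≤ (H.neighborSet x).ncard ∧ r ≤ (H.neighborSet y).ncard := by
  classical
  obtain ⟨f, hf⟩ := h
  have key : ∀ i j : Fin 2, i ≠ j → (if (i : ℕ) = 0 then k else r) ≤
      (H.neighborSet (f (Sum.inl i))).ncard := by
    intro i j hij
    let g : Option (Fin ((if (i : ℕ) = 0 then k else r) - spineExtra 2 (i : ℕ))) → V :=
      fun o => o.elim (f (Sum.inl j)) (fun t => f (Sum.inr ⟨i, t⟩))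
    have hg : Function.Injective g := by
      rintro (_ | a) (_ | b) hab
      · rfl
      · exact absurd (hf hab) (by simp)
      · exact absurd (hf hab) (by simp)
      · simpa using hf hab
    have hsub : Set.range g ⊆ H.neighborSet (f (Sum.inl i)) := by
      rintro _ ⟨_ | a, rfl⟩
      · refine f.map_adj ?_
        simp only [caterpillar, fromRel_adj]
        refine ⟨by simpa using hij, ?_⟩
        omega
      · refine f.map_adj ?_
        simp [caterpillar, fromRel_adj]
    have h1 := Set.ncard_le_ncard hsub (Set.toFinite _)
    rw [← Set.image_univ, Set.ncard_image_of_injective _ hg, Set.ncard_univ, Nat.card_eq_fintype_card,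
      Fintype.card_option, Fintype.card_fin] at h1
    have h2 : spineExtra 2 (i : ℕ) ≤ 1 := by
      fin_cases i <;> simp [spineExtra]
    omega
  refine ⟨f (Sum.inl 0), f (Sum.inl 1), f.map_adj ?_, ?_, ?_⟩
  · simp [caterpillar, fromRel_adj]
  · simpa using key 0 1 (by simp)
  · simpa using key 1 0 (by simp)

/-- In a triangle-free graph, adjacent vertices of degrees at least `k` and `r` span a copy of the
double star `S_{k×r}`. -/
lemma hasCopy_doubleStar_of_adj {V : Type*} [Finite V] {H : SimpleGraph V} {k r : ℕ}
    (htri : ∀ a b c, H.Adj a b → H.Adj b c → ¬ H.Adj a c) {x y : V} (hxy : H.Adj x y)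
    (hx : k ≤ (H.neighborSet x).ncard) (hy : r ≤ (H.neighborSet y).ncard) :
    HasCopy H (caterpillar 2 (fun t => if t = 0 then k else r)) := by
  classical
  have key : ∀ (m : ℕ) (a b : V), H.Adj a b → m ≤ (H.neighborSet a).ncard →
      ∃ g : Fin (m - 1) → V, Function.Injective g ∧ ∀ t, H.Adj a (g t) ∧ g t ≠ b := by
    intro m a b hab hm
    have h1 : m - 1 ≤ (H.neighborSet a \ {b}).ncard := by
      rw [Set.ncard_sdiff_singleton_of_mem (show b ∈ H.neighborSet a from hab)]
      omega
    have : Fintype V := Fintype.ofFinite V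
    obtain ⟨g⟩ : Nonempty (Fin (m - 1) ↪ ↥(H.neighborSet a \ {b})) := by
      apply Function.Embedding.nonempty_of_card_le
      rw [Fintype.card_fin, ← Nat.card_eq_fintype_card]
      exact h1
    exact ⟨fun t => g t, fun s t hst => g.injective (Subtype.ext hst),
      fun t => ⟨(g t).2.1, (g t).2.2⟩⟩
  have key2 : ∀ i : Fin 2, ∃ g : Fin ((if (i : ℕ) = 0 then k else r) - spineExtra 2 (i : ℕ)) → V,
      Function.Injective g ∧ ∀ t, H.Adj (![x, y] i) (g t) ∧ g t ≠ (![y, x] i) := by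
    rw [Fin.forall_fin_two]
    exact ⟨key k x y hxy hx, key r y x hxy.symm hy⟩
  choose g hg hadj using key2
  have hc : Function.Injective ![x, y] := by
    intro i j
    fin_cases i <;> fin_cases j <;> simp [hxy.ne, hxy.ne']
  have hcg : ∀ (i : Fin 2) (p : Σ i : Fin 2, Fin ((if (i : ℕ) = 0 then k else r) -
      spineExtra 2 (i : ℕ))), ![x, y] i ≠ g p.1 p.2 := by
    rintro i ⟨j, t⟩ h
    have h1 := hadj j t
    simp only at h
    rw [← h] at h1
    revert h1
    fin_cases i <;> fin_cases j <;> simp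
  refine ⟨⟨Sum.elim ![x, y] (fun p => g p.1 p.2), ?_⟩, ?_⟩
  · rintro (a | ⟨i, s⟩) (b | ⟨j, t⟩) huv <;>
      simp only [caterpillar, fromRel_adj, or_false, false_or, and_false] at huv
    · have hab : a ≠ b := by rintro rfl; simp at huv
      revert hab
      fin_cases a <;> fin_cases b <;> simp [hxy, hxy.symm]
    · obtain ⟨-, rfl⟩ := huv
      exact (hadj a t).1
    · obtain ⟨-, rfl⟩ := huv
      exact (hadj b s).1.symm
  · refine Function.Injective.sumElim hc ?_ hcg
    rintro ⟨i, s⟩ ⟨j, t⟩ h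
    simp only at h
    obtain rfl : i = j := by
      by_contra hij
      have h1 := (hadj i s).1
      have h2 := (hadj j t).1
      rw [← h] at h2
      revert h1 h2 hij
      generalize g i s = z
      fin_cases i <;> fin_cases j
      · simp
      · exact fun _ h1 h2 => htri x y z hxy h2 h1
      · exact fun _ h1 h2 => htri x y z hxy h1 h2
      · simp
    rw [hg i h]

/-- Flip the `i`-th coordinate of a vertex of the hypercube. -/
def flipAt {n : ℕ} (x : Fin n → Bool) (i : Fin n) : Fin n → Bool :=
  Function.update x i (!x i)

lemma flipAt_flipAt {n : ℕ} (x : Fin n → Bool) (i : Fin n) : flipAt (flipAt x i) i = x := by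
  simp [flipAt]

lemma flipAt_injective {n : ℕ} (x : Fin n → Bool) : Function.Injective (flipAt x) := by
  intro i j h
  by_contra hij
  have := congrFun h i
  simp [flipAt, Function.update_of_ne hij] at this

lemma hypercube_adj {n : ℕ} {x y : Fin n → Bool} :
    (hypercube n).Adj x y ↔ ∃ i, y = flipAt x i := by
  have h1 : (hypercube n).Adj x y ↔ hammingDist x y = 1 := by
    simp only [hypercube, fromRel_adj, hammingDist_comm y x, or_self, and_iff_right_iff_imp]
    rintro h rfl
    simp at h
  rw [h1, hammingDist, Finset.card_eq_one]
  refine exists_congr fun i => ?_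
  rw [Finset.ext_iff, funext_iff]
  refine forall_congr' fun j => ?_
  rw [Finset.mem_filter, Finset.mem_singleton, flipAt]
  by_cases hij : j = i
  · subst hij
    cases x j <;> cases y j <;> simp
  · simp [hij, eq_comm]

lemma hypercube_triangle_free {n : ℕ} (a b c : Fin n → Bool) (hab : (hypercube n).Adj a b)
    (hbc : (hypercube n).Adj b c) : ¬ (hypercube n).Adj a c := by
  rw [hypercube_adj] at *
  obtain ⟨i, rfl⟩ := hab
  obtain ⟨j, rfl⟩ := hbc
  rintro ⟨l, h⟩
  have hi := congrFun h i
  have hj := congrFun h j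
  have hl := congrFun h l
  by_cases hij : i = j
  · subst hij
    rw [flipAt_flipAt] at hl
    simp [flipAt] at hl
  · by_cases hil : i = l
    · subst hil
      simp [flipAt, Ne.symm hij] at hj
    · simp [flipAt, hij, hil] at hi

/-- The syndrome of `x` with respect to the parity-check columns `w`. -/
def syndrome {n : ℕ} {V : Type*} [AddCommMonoid V] (w : Fin n → V) (x : Fin n → Bool) : V :=
  ∑ i, if x i then w i else 0

lemma syndrome_flipAt {n : ℕ} {V : Type*} [AddCommGroup V] (h2 : ∀ v : V, v + v = 0)
    (w : Fin n → V) (x : Fin n → Bool) (i : Fin n) :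
    syndrome w (flipAt x i) = syndrome w x + w i := by
  rw [syndrome, syndrome, ← Finset.add_sum_erase _ _ (Finset.mem_univ i),
    ← Finset.add_sum_erase _ (fun j => if x j then w j else 0) (Finset.mem_univ i)]
  have : ∑ j ∈ Finset.univ.erase i, (if flipAt x i j then w j else 0) =
      ∑ j ∈ Finset.univ.erase i, if x j then w j else 0 := by
    refine Finset.sum_congr rfl fun j hj => ?_
    simp [flipAt, Finset.ne_of_mem_erase hj]
  rw [this]
  cases hx : x i
  · simp [flipAt, hx, add_comm]
  · have h3 := h2 (w i)
    simp only [flipAt, hx, Function.update_self]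
    simp only [Bool.not_true, Bool.false_eq_true, if_false, if_true, zero_add]
    rw [add_right_comm, h3, zero_add]

/-- The directions in which the edges of `codeGraph w J` at `x` go. -/
def codeDirs {n : ℕ} {V : Type*} [AddCommMonoid V] (w : Fin n → V) (J : Set (Fin n))
    (x : Fin n → Bool) : Set (Fin n) :=
  {i | (w i ≠ 0 ∧ (syndrome w x = 0 ∨ syndrome w x = w i)) ∨
    (w i = 0 ∧ i ∈ J ∧ syndrome w x ≠ 0)}

lemma mem_codeDirs_flipAt {n : ℕ} {V : Type*} [AddCommGroup V] (h2 : ∀ v : V, v + v = 0)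
    {w : Fin n → V} {J : Set (Fin n)} {x : Fin n → Bool} {i : Fin n}
    (h : i ∈ codeDirs w J x) : i ∈ codeDirs w J (flipAt x i) := by
  simp only [codeDirs, Set.mem_ofPred_eq, syndrome_flipAt h2] at *
  rcases h with ⟨h0, h | h⟩ | ⟨h0, h, h'⟩
  · simp [h, h0]
  · simp [h, h0, h2]
  · simp [h, h0, h']

/-- Join every codeword (vertex of syndrome zero) to its neighbours in the directions where `w` is
nonzero, and join any two non-codewords that differ in a direction of `J` where `w` vanishes. -/
def codeGraph {n : ℕ} {V : Type*} [AddCommGroup V] (h2 : ∀ v : V, v + v = 0)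
    (w : Fin n → V) (J : Set (Fin n)) : SimpleGraph (Fin n → Bool) where
  Adj x y := ∃ i ∈ codeDirs w J x, y = flipAt x i
  symm := ⟨by
    rintro x _ ⟨i, hi, rfl⟩
    exact ⟨i, mem_codeDirs_flipAt h2 hi, (flipAt_flipAt x i).symm⟩⟩
  loopless := ⟨by
    rintro x ⟨i, -, h⟩
    have := congrFun h i
    simp [flipAt] at this⟩

section CodeGraph

variable {n : ℕ} {V : Type*} [AddCommGroup V] (h2 : ∀ v : V, v + v = 0) {w : Fin n → V}
  {J : Set (Fin n)}

lemma ncard_neighborSet_codeGraph (x : Fin n → Bool) :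
    ((codeGraph h2 w J).neighborSet x).ncard = (codeDirs w J x).ncard := by
  rw [← Set.ncard_image_of_injective _ (flipAt_injective x)]
  congr 1
  ext y
  simp [codeGraph, eq_comm]

lemma codeGraph_le_hypercube : codeGraph h2 w J ≤ hypercube n := by
  rintro x y ⟨i, -, h⟩
  exact hypercube_adj.2 ⟨i, h⟩

lemma not_codeGraph_adj_of_syndrome_eq_zero {x y : Fin n → Bool} (hx : syndrome w x = 0)
    (hy : syndrome w y = 0) : ¬ (codeGraph h2 w J).Adj x y := by
  rintro ⟨i, hi, rfl⟩
  rw [syndrome_flipAt h2, hx, zero_add] at hy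
  simp [codeDirs, hx, hy] at hi

lemma codeDirs_of_syndrome_eq_zero {x : Fin n → Bool} (hx : syndrome w x = 0) :
    codeDirs w J x = {i | w i ≠ 0} := by
  ext i
  simp [codeDirs, hx]

lemma ncard_codeDirs_of_syndrome_ne_zero (hinj : Set.InjOn w {i | w i ≠ 0})
    (hsurj : ∀ v ≠ 0, ∃ i, w i = v) (hJ : ∀ i ∈ J, w i = 0) {x : Fin n → Bool}
    (hx : syndrome w x ≠ 0) : (codeDirs w J x).ncard = J.ncard + 1 := by
  obtain ⟨i, hi⟩ := hsurj _ hx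
  have hiJ : i ∉ J := fun h => hx (hi ▸ hJ i h)
  rw [← Set.ncard_insert_of_notMem hiJ]
  congr 1
  ext j
  simp only [codeDirs, Set.mem_ofPred_eq, Set.mem_insert_iff]
  constructor
  · rintro (⟨hj, h | h⟩ | h)
    · exact absurd h hx
    · exact Or.inl (hinj hj (by simpa [hi] using hx) (by rw [hi, h]))
    · exact Or.inr h.2.1
  · rintro (rfl | h)
    · exact Or.inl ⟨hi ▸ hx, Or.inr hi.symm⟩
    · exact Or.inr ⟨hJ j h, h, hx⟩

lemma exists_codeGraph_adj_syndrome_eq_zero (hsurj : ∀ v ≠ 0, ∃ i, w i = v) {x : Fin n → Bool}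
    (hx : syndrome w x ≠ 0) : ∃ b, (codeGraph h2 w J).Adj b x ∧ syndrome w b = 0 := by
  obtain ⟨i, hi⟩ := hsurj _ hx
  refine ⟨flipAt x i, SimpleGraph.Adj.symm ⟨i, ?_, rfl⟩, ?_⟩
  · exact Or.inl ⟨hi ▸ hx, Or.inr hi.symm⟩
  · rw [syndrome_flipAt h2, hi, h2]

lemma isSat_codeGraph {k r : ℕ} (hr : 2 ≤ r) (hkr : r ≤ k) (hinj : Set.InjOn w {i | w i ≠ 0})
    (hsurj : ∀ v ≠ 0, ∃ i, w i = v) (hJ : ∀ i ∈ J, w i = 0) (hJr : J.ncard = r - 2)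
    (hk : k ≤ {i | w i ≠ 0}.ncard) :
    IsSat (hypercube n) (codeGraph h2 w J)
      (caterpillar 2 (fun t => if t = 0 then k else r)) := by
  have hdeg0 : ∀ x, syndrome w x = 0 → k ≤ ((codeGraph h2 w J).neighborSet x).ncard := by
    intro x hx
    rwa [ncard_neighborSet_codeGraph, codeDirs_of_syndrome_eq_zero hx]
  have hdeg1 : ∀ x, syndrome w x ≠ 0 →
      ((codeGraph h2 w J).neighborSet x).ncard + 1 = r := by
    intro x hx
    rw [ncard_neighborSet_codeGraph, ncard_codeDirs_of_syndrome_ne_zero hinj hsurj hJ hx]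
    omega
  refine ⟨codeGraph_le_hypercube h2, ?_, ?_⟩
  · intro h
    obtain ⟨x, y, hxy, hx, hy⟩ := exists_adj_of_hasCopy_doubleStar h
    refine not_codeGraph_adj_of_syndrome_eq_zero h2 ?_ ?_ hxy <;> by_contra h0
    · have := hdeg1 x h0
      omega
    · have := hdeg1 y h0
      omega
  · have main : ∀ x y, (hypercube n).Adj x y → ¬ (codeGraph h2 w J).Adj x y →
        (syndrome w x = 0 → syndrome w y = 0) →
        HasCopy (codeGraph h2 w J ⊔ fromEdgeSet {s(x, y)})
          (caterpillar 2 (fun t => if t = 0 then k else r)) := by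
      intro x y hxy hn himp
      have hle : codeGraph h2 w J ⊔ fromEdgeSet {s(x, y)} ≤ hypercube n := by
        refine sup_le (codeGraph_le_hypercube h2) ?_
        intro a b hab
        simp only [fromEdgeSet_adj, Set.mem_singleton_iff, Sym2.eq_iff] at hab
        rcases hab.1 with ⟨rfl, rfl⟩ | ⟨rfl, rfl⟩
        exacts [hxy, hxy.symm]
      have htri : ∀ a b c, (codeGraph h2 w J ⊔ fromEdgeSet {s(x, y)}).Adj a b →
          (codeGraph h2 w J ⊔ fromEdgeSet {s(x, y)}).Adj b c →
          ¬ (codeGraph h2 w J ⊔ fromEdgeSet {s(x, y)}).Adj a c :=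
        fun a b c hab hbc hac => hypercube_triangle_free a b c (hle hab) (hle hbc) (hle hac)
      have hnew : (codeGraph h2 w J ⊔ fromEdgeSet {s(x, y)}).Adj x y := by
        simp [hxy.ne]
      have hmono : ∀ a, (codeGraph h2 w J).neighborSet a ⊆
          (codeGraph h2 w J ⊔ fromEdgeSet {s(x, y)}).neighborSet a :=
        fun a b hab => Or.inl hab
      have hdeg0' : ∀ a, syndrome w a = 0 →
          k ≤ ((codeGraph h2 w J ⊔ fromEdgeSet {s(x, y)}).neighborSet a).ncard :=
        fun a ha => (hdeg0 a ha).trans (Set.ncard_le_ncard (hmono a) (Set.toFinite _))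
      by_cases hx : syndrome w x = 0
      · exact hasCopy_doubleStar_of_adj htri hnew (hdeg0' x hx)
          (hkr.trans (hdeg0' y (himp hx)))
      · obtain ⟨b, hbx, hb⟩ := exists_codeGraph_adj_syndrome_eq_zero h2 hsurj hx
        refine hasCopy_doubleStar_of_adj htri (Or.inl hbx) (hdeg0' b hb) ?_
        rw [← hdeg1 x hx, ← Set.ncard_insert_of_notMem
          (show y ∉ (codeGraph h2 w J).neighborSet x from hn)]
        exact Set.ncard_le_ncard (Set.insert_subset hnew (hmono x)) (Set.toFinite _)
    intro x y hxy hn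
    by_cases h : syndrome w x = 0 → syndrome w y = 0
    · exact main x y hxy hn h
    · rw [Sym2.eq_swap]
      exact main y x hxy.symm (fun h' => hn h'.symm)
        (fun hy => absurd (fun _ => hy) h)

lemma ncard_edgeSet_codeGraph_le (hinj : Set.InjOn w {i | w i ≠ 0})
    (hsurj : ∀ v ≠ 0, ∃ i, w i = v) (hJ : ∀ i ∈ J, w i = 0) :
    2 * (codeGraph h2 w J).edgeSet.ncard ≤ (J.ncard + 2) * 2 ^ n := by
  classical
  have hdeg : ∀ x, (codeGraph h2 w J).degree x = (codeDirs w J x).ncard := by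
    intro x
    rw [← ncard_neighborSet_codeGraph h2, ← Nat.card_coe_set_eq, Nat.card_eq_fintype_card,
      card_neighborSet_eq_degree]
  have hsum := (codeGraph h2 w J).sum_degrees_eq_twice_card_edges
  rw [← coe_edgeFinset, Set.ncard_coe_finset, ← hsum,
    ← Finset.sum_filter_add_sum_filter_not Finset.univ (fun x => syndrome w x = 0)]
  have hA : ∑ x with syndrome w x = 0, (codeGraph h2 w J).degree x ≤
      (Finset.univ.filter fun x => ¬ syndrome w x = 0).card := by
    have : ∑ x with syndrome w x = 0, (codeGraph h2 w J).degree x =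
        ((Finset.univ.filter fun x => syndrome w x = 0) ×ˢ
          (Finset.univ.filter fun i => w i ≠ 0)).card := by
      rw [Finset.card_product, ← smul_eq_mul, ← Finset.sum_const]
      refine Finset.sum_congr rfl fun x hx => ?_
      rw [hdeg, codeDirs_of_syndrome_eq_zero (Finset.mem_filter.1 hx).2,
        ← Set.ncard_coe_finset]
      simp
    rw [this]
    refine Finset.card_le_card_of_injOn (fun p => flipAt p.1 p.2) ?_ ?_
    · rintro ⟨x, i⟩ h
      simp_all [syndrome_flipAt h2]
    · rintro ⟨x, i⟩ hx ⟨y, j⟩ hy h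
      simp only [Finset.coe_product, Finset.coe_filter, Finset.mem_univ, true_and, Set.mem_prod,
        Set.mem_ofPred_eq] at hx hy h
      have h' := congrArg (syndrome w) h
      rw [syndrome_flipAt h2, syndrome_flipAt h2, hx.1, hy.1, zero_add, zero_add] at h'
      obtain rfl := hinj hx.2 hy.2 h'
      rw [← flipAt_flipAt x i, h, flipAt_flipAt]
  have hB : ∑ x with ¬ syndrome w x = 0, (codeGraph h2 w J).degree x =
      (Finset.univ.filter fun x => ¬ syndrome w x = 0).card * (J.ncard + 1) := by
    rw [← smul_eq_mul, ← Finset.sum_const]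
    refine Finset.sum_congr rfl fun x hx => ?_
    rw [hdeg, ncard_codeDirs_of_syndrome_ne_zero hinj hsurj hJ (Finset.mem_filter.1 hx).2]
  have hC : (Finset.univ.filter fun x => ¬ syndrome w x = 0).card ≤ 2 ^ n :=
    (Finset.card_le_univ _).trans (by simp)
  nlinarith

end CodeGraph

/-- Columns of a Hamming parity-check matrix, padded with zero columns. -/
lemma exists_parity_columns {n : ℕ} (V : Type*) [Zero V] [Fintype V] (hn : Fintype.card V ≤ n) :
    ∃ w : Fin n → V, Set.InjOn w {i | w i ≠ 0} ∧ (∀ v ≠ 0, ∃ i, w i = v) ∧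
      {i | w i ≠ 0}.ncard + 1 = Fintype.card V := by
  classical
  obtain ⟨e⟩ : Nonempty (V ↪ Fin n) :=
    Function.Embedding.nonempty_of_card_le (by simpa using hn)
  have he : ∀ v, Function.extend e id 0 (e v) = v := fun v => e.injective.extend_apply _ _ v
  have hne : ∀ i, Function.extend e id 0 i ≠ 0 → ∃ v, e v = i := by
    intro i hi
    by_contra h
    exact hi (Function.extend_apply' _ _ _ h)
  refine ⟨Function.extend e id 0, ?_, fun v _ => ⟨e v, he v⟩, ?_⟩
  · intro i hi j hj hij
    obtain ⟨a, rfl⟩ := hne i hi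
    obtain ⟨b, rfl⟩ := hne j hj
    rw [he, he] at hij
    rw [hij]
  · have : {i | Function.extend e id 0 i ≠ 0} = e '' {0}ᶜ := by
      ext i
      constructor
      · intro hi
        obtain ⟨v, rfl⟩ := hne i hi
        exact ⟨v, by simpa [he] using hi, rfl⟩
      · rintro ⟨v, hv, rfl⟩
        simpa [he] using hv
    rw [this, Set.ncard_image_of_injective _ e.injective, ← Nat.card_eq_fintype_card,
      ← Set.ncard_add_ncard_compl ({0} : Set V), Set.ncard_singleton, add_comm]

/-- for the double star `S_{k×r}` with `k ≥ r ≥ 2`,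
`sat(Q_n, S_{k×r}) ≤ r·2^(n-1)` for all sufficiently large `n`. -/
theorem stmt5 (k r : ℕ) (hr : 2 ≤ r) (hkr : r ≤ k) :
    ∃ N : ℕ, ∀ n ≥ N,
      satNum (hypercube n) (caterpillar 2 (fun t => if t = 0 then k else r)) ≤
        r * 2 ^ (n - 1) := by
  refine ⟨2 ^ k + r, fun n hn => ?_⟩
  have h2 : ∀ v : Fin k → ZMod 2, v + v = 0 := fun v => funext fun i => CharTwo.add_self_eq_zero _
  have hcard : Fintype.card (Fin k → ZMod 2) = 2 ^ k := by simp [ZMod.card]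
  obtain ⟨w, hinj, hsurj, hw⟩ := exists_parity_columns (n := n) (Fin k → ZMod 2) (by omega)
  obtain ⟨J, hJ, hJr⟩ : ∃ J ⊆ {i | w i ≠ 0}ᶜ, J.ncard = r - 2 := by
    refine Set.exists_subset_card_eq ?_
    have := Set.ncard_add_ncard_compl {i | w i ≠ 0}
    rw [Nat.card_eq_fintype_card, Fintype.card_fin] at this
    omega
  replace hJ : ∀ i ∈ J, w i = 0 := fun i hi => by simpa using hJ hi
  have hk : k ≤ {i | w i ≠ 0}.ncard := by
    have := Nat.lt_two_pow_self (n := k)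
    omega
  have hs : satNum (hypercube n) (caterpillar 2 (fun t => if t = 0 then k else r)) ≤
      (codeGraph h2 w J).edgeSet.ncard :=
    Nat.sInf_le ⟨_, isSat_codeGraph h2 hr hkr hinj hsurj hJ hJr hk, rfl⟩
  have hle := ncard_edgeSet_codeGraph_le h2 hinj hsurj hJ
  obtain ⟨m, rfl⟩ : ∃ m, n = m + 1 := ⟨n - 1, by omega⟩
  rw [hJr, Nat.sub_add_cancel hr, pow_succ] at hle
  rw [Nat.add_sub_cancel]
  linarith
end
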